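/- arXiv:quant-ph/0205166 — 9 statements merged into one kernel-verified Lean document; each statement's English description precedes it below -/
import Mathlib

section
/- Let (Σ1, ⊥1) and (Σ2, ⊥2) be orthogonality spaces, and equip Σ1 × Σ2 with the product orthogonality. Then for every p1 ∈ Σ1 and p2 ∈ Σ2: ({p1} × Σ2 ∪ Σ1 × {p2})^⊥ = {p1}^⊥ × {p2}^⊥. -/
/-- The orthogonal set of `A`: all points orthogonal to every point of `A`. -/
def orthoSet {α : Type*} (perp : α → α → Prop) (A : Set α) : Set α :=
  {q | ∀ p ∈ A, perp q p}

/-- The product orthogonality on `α × β`: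
`(p1, p2) ⊥ (q1, q2)` iff `p1 ⊥1 q1` or `p2 ⊥2 q2`. -/
def prodPerp {α β : Type*} (perp1 : α → α → Prop) (perp2 : β → β → Prop) :
    α × β → α × β → Prop :=
  fun x y => perp1 x.1 y.1 ∨ perp2 x.2 y.2


/-- The orthogonal of {p1} × Σ2 ∪ Σ1 × {p2} in the product orthogonality space is {p1}^⊥ × {p2}^⊥. -/
theorem ortho_union_lines {α β : Type*} (perp1 : α → α → Prop) (perp2 : β → β → Prop)
    (h1_irrefl : ∀ x, ¬ perp1 x x) (h1_symm : ∀ x y, perp1 x y → perp1 y x)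
    (h2_irrefl : ∀ x, ¬ perp2 x x) (h2_symm : ∀ x y, perp2 x y → perp2 y x)
    (p1 : α) (p2 : β) :
    orthoSet (prodPerp perp1 perp2)
        (({p1} : Set α) ×ˢ (Set.univ : Set β) ∪ (Set.univ : Set α) ×ˢ ({p2} : Set β)) =
      (orthoSet perp1 {p1}) ×ˢ (orthoSet perp2 {p2}) := by
  ext ⟨a, b⟩
  constructor
  · intro h
    refine ⟨?_, ?_⟩
    · rintro _ rfl
      exact (h (_, b) (Or.inl ⟨rfl, trivial⟩)).resolve_right (h2_irrefl b)
    · rintro _ rfl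
      exact (h (a, _) (Or.inr ⟨trivial, rfl⟩)).resolve_left (h1_irrefl a)
  · rintro ⟨ha, hb⟩ ⟨c, d⟩ (⟨hc, -⟩ | ⟨-, hd⟩)
    · exact Or.inl (ha c hc)
    · exact Or.inr (hb d hd)
end

section
/- Let (Σ1, ⊥1) and (Σ2, ⊥2) be orthogonality spaces, and equip Σ1 × Σ2 with the product orthogonality. If M1 ⊆ Σ1 and M2 ⊆ Σ2 are biorthogonally closed (M1 = M1^⊥⊥ and M2 = M2^⊥⊥), then M1 × M2 is biorthogonally closed in Σ1 × Σ2, i.e. (M1 × M2)^⊥⊥ = M1 × M2. -/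
/-- Every set is contained in its biorthogonal closure. -/
theorem subset_orthoSet_orthoSet {α : Type*} {perp : α → α → Prop}
    (h_symm : ∀ x y, perp x y → perp y x) (A : Set α) :
    A ⊆ orthoSet perp (orthoSet perp A) :=
  fun x hx q hq => h_symm q x (hq x hx)

/-- Products of biorthogonally closed sets are biorthogonally closed in the product
orthogonality space. -/
theorem biortho_closed_prod {α β : Type*} (perp1 : α → α → Prop) (perp2 : β → β → Prop)
    (h1_irrefl : ∀ x, ¬ perp1 x x) (h1_symm : ∀ x y, perp1 x y → perp1 y x)
    (h2_irrefl : ∀ x, ¬ perp2 x x) (h2_symm : ∀ x y, perp2 x y → perp2 y x)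
    (M1 : Set α) (M2 : Set β)
    (hM1 : orthoSet perp1 (orthoSet perp1 M1) = M1)
    (hM2 : orthoSet perp2 (orthoSet perp2 M2) = M2) :
    orthoSet (prodPerp perp1 perp2) (orthoSet (prodPerp perp1 perp2) (M1 ×ˢ M2)) =
      M1 ×ˢ M2 := by
  apply Set.Subset.antisymm
  · rintro ⟨x, y⟩ h
    constructor
    · rw [← hM1]
      intro a ha
      exact (h (a, y) fun p hp => Or.inl (ha p.1 hp.1)).resolve_right (h2_irrefl y)
    · rw [← hM2]
      intro b hb
      exact (h (x, b) fun p hp => Or.inr (hb p.2 hp.2)).resolve_left (h1_irrefl x)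
  · exact subset_orthoSet_orthoSet
      (fun x y => Or.imp (h1_symm x.1 y.1) (h2_symm x.2 y.2)) _
end

section
/- Let (Σ1, ⊥1) and (Σ2, ⊥2) be T1 orthogonality spaces, and equip Σ1 × Σ2 with the product orthogonality. If p1, q1 ∈ Σ1 with p1 ≠ q1 and p2, q2 ∈ Σ2 with p2 ≠ q2, then the two-element set {(p1, p2), (q1, q2)} is biorthogonally closed: {(p1, p2), (q1, q2)}^⊥⊥ = {(p1, p2), (q1, q2)}. -/
/-- If every pair orthogonal in its components to `a` and `b` respectively is orthogonal to `z`
in the product of T1 spaces, then `z` agrees with `(a, b)` in at least one component. -/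
theorem eq_or_eq_of_prodPerp {α β : Type*} {perp1 : α → α → Prop} {perp2 : β → β → Prop}
    (hT1_1 : ∀ p : α, orthoSet perp1 (orthoSet perp1 {p}) = {p})
    (hT1_2 : ∀ p : β, orthoSet perp2 (orthoSet perp2 {p}) = {p})
    {a : α} {b : β} {z : α × β}
    (h : ∀ x y, perp1 x a → perp2 y b → prodPerp perp1 perp2 z (x, y)) :
    z.1 = a ∨ z.2 = b := by
  by_contra! hne
  have hz1 : z.1 ∉ orthoSet perp1 (orthoSet perp1 {a}) := by rw [hT1_1]; exact hne.1
  have hz2 : z.2 ∉ orthoSet perp2 (orthoSet perp2 {b}) := by rw [hT1_2]; exact hne.2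
  simp only [orthoSet, Set.mem_ofPred_eq, not_forall] at hz1 hz2
  obtain ⟨x, hx, hzx⟩ := hz1
  obtain ⟨y, hy, hzy⟩ := hz2
  exact (h x y (hx a rfl) (hy b rfl)).elim hzx hzy

/-- In the product of two T1 orthogonality spaces, every two-element set
`{(p1, p2), (q1, q2)}` with `p1 ≠ q1` and `p2 ≠ q2` is biorthogonally closed. -/
theorem two_element_biortho_closed {α β : Type*} (perp1 : α → α → Prop) (perp2 : β → β → Prop)
    (h1_irrefl : ∀ x, ¬ perp1 x x) (h1_symm : ∀ x y, perp1 x y → perp1 y x)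
    (h2_irrefl : ∀ x, ¬ perp2 x x) (h2_symm : ∀ x y, perp2 x y → perp2 y x)
    (hT1_1 : ∀ p : α, orthoSet perp1 (orthoSet perp1 {p}) = {p})
    (hT1_2 : ∀ p : β, orthoSet perp2 (orthoSet perp2 {p}) = {p})
    (p1 q1 : α) (p2 q2 : β) (hq1 : p1 ≠ q1) (hq2 : p2 ≠ q2) :
    orthoSet (prodPerp perp1 perp2)
        (orthoSet (prodPerp perp1 perp2) {(p1, p2), (q1, q2)}) =
      ({(p1, p2), (q1, q2)} : Set (α × β)) := by
  have mem_ortho : ∀ z, z ∈ orthoSet (prodPerp perp1 perp2) {(p1, p2), (q1, q2)} ↔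
      prodPerp perp1 perp2 z (p1, p2) ∧ prodPerp perp1 perp2 z (q1, q2) := by
    simp [orthoSet]
  have prod_symm : ∀ x y, prodPerp perp1 perp2 x y → prodPerp perp1 perp2 y x :=
    fun _ _ h => h.imp (h1_symm _ _) (h2_symm _ _)
  ext ⟨r, s⟩
  constructor
  · intro h
    have hpq : r = p1 ∨ s = q2 := eq_or_eq_of_prodPerp (z := (r, s)) hT1_1 hT1_2
      fun x y hx hy => h _ ((mem_ortho (x, y)).2 ⟨Or.inl hx, Or.inr hy⟩)
    have hqp : r = q1 ∨ s = p2 := eq_or_eq_of_prodPerp (z := (r, s)) hT1_1 hT1_2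
      fun x y hx hy => h _ ((mem_ortho (x, y)).2 ⟨Or.inr hy, Or.inl hx⟩)
    simp only [Set.mem_insert_iff, Set.mem_singleton_iff, Prod.mk.injEq]
    grind
  · intro h z hz
    exact prod_symm _ _ (hz _ h)
end

section
/- Let Σ be the set of one-dimensional subspaces (rays) of the complex Hilbert space ℂ², with orthogonality P ⊥ Q iff P ≤ Qᗮ, and equip Σ × Σ with the product orthogonality. Let P1, P2, P3 ∈ Σ be pairwise distinct rays and Q1, Q2, Q3 ∈ Σ be pairwise distinct rays. Set b = {(P1, Q1), (P2, Q2)}, c = {(P3, Q3)}, and d = ({P1} × Σ) ∪ (Σ × {Q2}). Then: (i) b and c are biorthogonally closed and b ∩ c = ∅; (ii) (b ∪ c)^⊥⊥ = Σ × Σ; (iii) d is biorthogonally closed and b ⊊ d ⊊ Σ × Σ. Consequently the join b ∨ c does not cover b, so the covering law fails in the lattice of biorthogonally closed subsets of Σ × Σ. -/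
/-- The set of rays (one-dimensional subspaces) of the Hilbert space `ℂ²`. -/
def RayC2 : Type := {P : Submodule ℂ (EuclideanSpace ℂ (Fin 2)) // Module.finrank ℂ P = 1}

/-- Orthogonality of rays of `ℂ²`: `P ⊥ Q` iff `P ≤ Qᗮ`. -/
def rayPerp (P Q : RayC2) : Prop := P.1 ≤ (Q.1)ᗮ


/-- The orthogonal complement of a ray of `ℂ²`, again a ray. -/
noncomputable def RayC2.compl (P : RayC2) : RayC2 :=
  ⟨(P.1)ᗮ, Submodule.finrank_add_finrank_orthogonal'
    (K := P.1) (by simp [P.2])⟩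

theorem RayC2.compl_involutive : Function.Involutive RayC2.compl := fun P =>
  Subtype.ext (Submodule.orthogonal_orthogonal P.1)

theorem rayPerp_iff_eq_compl (P Q : RayC2) : rayPerp P Q ↔ P = Q.compl :=
  ⟨fun h => Subtype.ext (Submodule.eq_of_le_of_finrank_eq h (P.2.trans Q.compl.2.symm)),
    fun h => (congrArg Subtype.val h).le⟩

section Involution

variable {α β : Type*} {perp1 : α → α → Prop} {perp2 : β → β → Prop} {f : α → α} {g : β → β}

theorem orthoSet_union {γ : Type*} (perp : γ → γ → Prop) (A B : Set γ) :
    orthoSet perp (A ∪ B) = orthoSet perp A ∩ orthoSet perp B := by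
  ext q
  simp only [orthoSet, Set.mem_union, Set.mem_inter_iff, Set.mem_ofPred_eq]
  exact ⟨fun h => ⟨fun p hp => h p (Or.inl hp), fun p hp => h p (Or.inr hp)⟩,
    fun h p hp => hp.elim (h.1 p) (h.2 p)⟩

theorem orthoSet_prodPerp_singleton (h1 : ∀ p q, perp1 p q ↔ p = f q)
    (h2 : ∀ p q, perp2 p q ↔ p = g q) (p : α) (q : β) :
    orthoSet (prodPerp perp1 perp2) {(p, q)} = {f p} ×ˢ Set.univ ∪ Set.univ ×ˢ {g q} := by
  ext ⟨x, y⟩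
  simp [orthoSet, prodPerp, h1, h2]

theorem orthoSet_prodPerp_pair (h1 : ∀ p q, perp1 p q ↔ p = f q)
    (h2 : ∀ p q, perp2 p q ↔ p = g q) (hf : f.Injective) (hg : g.Injective)
    {p p' : α} {q q' : β} (hp : p ≠ p') (hq : q ≠ q') :
    orthoSet (prodPerp perp1 perp2) {(p, q), (p', q')} = {(f p, g q'), (f p', g q)} := by
  have hp' := hf.ne hp
  have hq' := hg.ne hq
  ext ⟨x, y⟩
  simp only [orthoSet, prodPerp, h1, h2, Set.mem_insert_iff, Set.mem_singleton_iff,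
    Set.mem_ofPred_eq, forall_eq_or_imp, forall_eq, Prod.mk.injEq]
  grind

theorem orthoSet_prodPerp_cross [Nontrivial α] [Nontrivial β] (h1 : ∀ p q, perp1 p q ↔ p = f q)
    (h2 : ∀ p q, perp2 p q ↔ p = g q) (hf : f.Injective) (hg : g.Injective) (p : α) (q : β) :
    orthoSet (prodPerp perp1 perp2) ({p} ×ˢ Set.univ ∪ Set.univ ×ˢ {q}) = {(f p, g q)} := by
  ext ⟨x, y⟩
  simp only [orthoSet, prodPerp, h1, h2, Set.mem_singleton_iff, Set.mem_ofPred_eq, Set.mem_union,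
    Set.mem_prod, Set.mem_univ, and_true, true_and, Prod.forall, Prod.mk.injEq]
  refine ⟨fun h => ?_, ?_⟩
  · constructor
    · by_contra hx
      obtain ⟨a, b, hab⟩ := exists_pair_ne β
      have ha := (h p a (Or.inl rfl)).resolve_left hx
      have hb := (h p b (Or.inl rfl)).resolve_left hx
      exact hab (hg (ha.symm.trans hb))
    · by_contra hy
      obtain ⟨a, b, hab⟩ := exists_pair_ne α
      have ha := (h a q (Or.inr rfl)).resolve_right hy
      have hb := (h b q (Or.inr rfl)).resolve_right hy
      exact hab (hf (ha.symm.trans hb))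
  · rintro ⟨rfl, rfl⟩ a b (rfl | rfl) <;> simp

end Involution

/-- Failure of the covering law for two separated spin 1/2 systems: in the lattice of
biorthogonally closed subsets of `Σ × Σ` (where `Σ` is the set of rays of `ℂ²` and the
product orthogonality is used), with `b = {(P1, Q1), (P2, Q2)}`, `c = {(P3, Q3)}` and
`d = ({P1} × Σ) ∪ (Σ × {Q2})` for pairwise distinct rays `P1, P2, P3` and pairwise
distinct rays `Q1, Q2, Q3`: `b` and `c` are biorthogonally closed and disjoint, the join
`b ∨ c = (b ∪ c)^⊥⊥` is everything, and `d` is biorthogonally closed with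
`b ⊊ d ⊊ Σ × Σ`; so `b ∨ c` does not cover `b`. -/
theorem covering_law_fails (P1 P2 P3 Q1 Q2 Q3 : RayC2)
    (hP12 : P1 ≠ P2) (hP13 : P1 ≠ P3) (hP23 : P2 ≠ P3)
    (hQ12 : Q1 ≠ Q2) (hQ13 : Q1 ≠ Q3) (hQ23 : Q2 ≠ Q3) :
    let pp := prodPerp rayPerp rayPerp
    let b : Set (RayC2 × RayC2) := {(P1, Q1), (P2, Q2)}
    let c : Set (RayC2 × RayC2) := {(P3, Q3)}
    let d : Set (RayC2 × RayC2) :=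
      ({P1} : Set RayC2) ×ˢ (Set.univ : Set RayC2) ∪
      (Set.univ : Set RayC2) ×ˢ ({Q2} : Set RayC2)
    (orthoSet pp (orthoSet pp b) = b ∧ orthoSet pp (orthoSet pp c) = c ∧ b ∩ c = ∅) ∧
    orthoSet pp (orthoSet pp (b ∪ c)) = Set.univ ∧
    (orthoSet pp (orthoSet pp d) = d ∧ b ⊂ d ∧ d ⊂ Set.univ) := by
  intro pp b c d
  have hc := RayC2.compl_involutive
  have hi := hc.injective
  have : Nontrivial RayC2 := ⟨P1, P2, hP12⟩
  have hs := orthoSet_prodPerp_singleton rayPerp_iff_eq_compl rayPerp_iff_eq_compl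
  have hd := orthoSet_prodPerp_cross rayPerp_iff_eq_compl rayPerp_iff_eq_compl hi hi
  have hb : orthoSet pp b = {(P1.compl, Q2.compl), (P2.compl, Q1.compl)} :=
    orthoSet_prodPerp_pair rayPerp_iff_eq_compl rayPerp_iff_eq_compl hi hi hP12 hQ12
  refine ⟨⟨?_, ?_, ?_⟩, ?_, ?_, ?_, ?_⟩
  · rw [hb, orthoSet_prodPerp_pair rayPerp_iff_eq_compl rayPerp_iff_eq_compl hi hi
      (hi.ne hP12) (hi.ne hQ12.symm)]
    simp only [hc _, b]
  · simp only [pp, c, hs, hd, hc _]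
  · simp [b, c, hP13.symm, hP23.symm]
  · have hbc : orthoSet pp (b ∪ c) = ∅ := by
      rw [orthoSet_union, hb, hs]
      ext ⟨x, y⟩
      have := hi.ne hP13
      have := hi.ne hP23
      have := hi.ne hQ13
      have := hi.ne hQ23
      simp only [Set.mem_inter_iff, Set.mem_insert_iff, Set.mem_singleton_iff, Set.mem_union,
        Set.mem_prod, Set.mem_univ, Set.mem_empty_iff_false, Prod.mk.injEq]
      grind
    rw [hbc]
    simp [orthoSet]
  · simp only [pp, d, hs, hd, hc _]
  · refine Set.ssubset_iff_exists.2 ⟨?_, (P1, Q3), by simp [d], ?_⟩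
    · rintro _ (rfl | rfl) <;> simp [d]
    · simp [b, hQ13.symm, hQ23.symm]
  · exact Set.ssubset_univ_iff.2 fun h =>
      absurd (h ▸ Set.mem_univ (P2, Q1) : (P2, Q1) ∈ d) (by simp [d, hP12.symm, hQ12])
end

section
/- Let Σ be the set of one-dimensional subspaces (rays) of ℂ², with orthogonality P ⊥ Q iff P ≤ Qᗮ, and equip Σ × Σ with the product orthogonality. If P1 ≠ P2 and Q1 ≠ Q2 are rays, then {(P1, Q1), (P2, Q2)}^⊥ = {(P1ᗮ, Q2ᗮ), (P2ᗮ, Q1ᗮ)}, where Pᗮ denotes the unique ray orthogonal to P. -/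
theorem rayPerp_iff_eq {P Q Qc : RayC2} (hQ : Qc.1 = (Q.1)ᗮ) : rayPerp P Q ↔ P = Qc := by
  unfold rayPerp
  rw [← hQ]
  refine ⟨fun h => Subtype.ext ?_, fun h => h ▸ le_rfl⟩
  have : Module.finrank ℂ P.1 = Module.finrank ℂ Qc.1 := P.2.trans Qc.2.symm
  exact Submodule.eq_of_le_of_finrank_eq h this

theorem RayC2.ne_of_eq_orthogonal {P Q Pc Qc : RayC2} (h : P ≠ Q) (hP : Pc.1 = (P.1)ᗮ)
    (hQ : Qc.1 = (Q.1)ᗮ) : Pc ≠ Qc := by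
  rintro rfl
  refine h (Subtype.ext ?_)
  rw [← Submodule.orthogonal_orthogonal P.1, ← hP, hQ, Submodule.orthogonal_orthogonal]

/-- For rays `P1 ≠ P2` and `Q1 ≠ Q2` of `ℂ²`, the orthogonal of the two-element set
`{(P1, Q1), (P2, Q2)}` in the product orthogonality is `{(P1ᗮ, Q2ᗮ), (P2ᗮ, Q1ᗮ)}`,
where `Pᗮ` denotes the unique ray orthogonal to `P`. -/
theorem ortho_two_element (P1 P2 Q1 Q2 : RayC2) (hP : P1 ≠ P2) (hQ : Q1 ≠ Q2)
    (P1c P2c Q1c Q2c : RayC2)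
    (hP1c : P1c.1 = (P1.1)ᗮ) (hP2c : P2c.1 = (P2.1)ᗮ)
    (hQ1c : Q1c.1 = (Q1.1)ᗮ) (hQ2c : Q2c.1 = (Q2.1)ᗮ) :
    orthoSet (prodPerp rayPerp rayPerp) {(P1, Q1), (P2, Q2)} =
      ({(P1c, Q2c), (P2c, Q1c)} : Set (RayC2 × RayC2)) := by
  have hPc := RayC2.ne_of_eq_orthogonal hP hP1c hP2c
  have hQc := RayC2.ne_of_eq_orthogonal hQ hQ1c hQ2c
  ext ⟨x, y⟩
  simp only [orthoSet, prodPerp, Set.mem_ofPred_eq, Set.mem_insert_iff, Set.mem_singleton_iff,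
    forall_eq_or_imp, forall_eq, rayPerp_iff_eq hP1c, rayPerp_iff_eq hP2c,
    rayPerp_iff_eq hQ1c, rayPerp_iff_eq hQ2c, Prod.mk.injEq]
  grind
end

section
/- Let (Σ1, ⊥1) and (Σ2, ⊥2) be orthogonality spaces, and equip Σ1 × Σ2 with the product orthogonality. Let M1 ⊆ Σ1 and M2 ⊆ Σ2 be biorthogonally closed, and let (p1, p2) ∈ Σ1 × Σ2 with p1 ∉ M1^⊥ and p2 ∉ M2^⊥. Then the Sasaki projection of (p1, p2) onto M1 × M2 factorizes: ({(p1, p2)} ∪ (M1 × M2)^⊥)^⊥⊥ ∩ (M1 × M2) = [({p1} ∪ M1^⊥)^⊥⊥ ∩ M1] × [({p2} ∪ M2^⊥)^⊥⊥ ∩ M2]. -/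
/-- The orthogonal set of `{p} ∪ M^⊥`, for `M` biorthogonally closed, is the part of `M`
orthogonal to `p`. -/
theorem mem_orthoSet_singleton_union {α : Type*} {perp : α → α → Prop} {M : Set α}
    (hM : orthoSet perp (orthoSet perp M) = M) (p x : α) :
    x ∈ orthoSet perp ({p} ∪ orthoSet perp M) ↔ perp x p ∧ x ∈ M := by
  conv_rhs => rw [← hM]
  simp [orthoSet]

/-- A product of biorthogonally closed sets is biorthogonally closed. -/
theorem orthoSet_orthoSet_prod {α β : Type*} {perp1 : α → α → Prop} {perp2 : β → β → Prop}
    (h1_irrefl : ∀ x, ¬ perp1 x x) (h1_symm : ∀ x y, perp1 x y → perp1 y x)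
    (h2_irrefl : ∀ x, ¬ perp2 x x) (h2_symm : ∀ x y, perp2 x y → perp2 y x)
    {M1 : Set α} {M2 : Set β}
    (hM1 : orthoSet perp1 (orthoSet perp1 M1) = M1)
    (hM2 : orthoSet perp2 (orthoSet perp2 M2) = M2) :
    orthoSet (prodPerp perp1 perp2) (orthoSet (prodPerp perp1 perp2) (M1 ×ˢ M2)) =
      M1 ×ˢ M2 := by
  ext ⟨x, y⟩
  constructor
  · intro h
    refine ⟨?_, ?_⟩
    · rw [← hM1]
      intro q hq
      exact (h (q, y) fun m hm => Or.inl (hq m.1 hm.1)).resolve_right (h2_irrefl y)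
    · rw [← hM2]
      intro q hq
      exact (h (x, q) fun m hm => Or.inr (hq m.2 hm.2)).resolve_left (h1_irrefl x)
  · intro h q hq
    exact (hq (x, y) h).imp (h1_symm _ _) (h2_symm _ _)

/-- The Sasaki projection of a point `(p1, p2)` onto a product `M1 × M2` of
biorthogonally closed sets factorizes as the product of the componentwise Sasaki
projections, provided `p1 ∉ M1^⊥` and `p2 ∉ M2^⊥`. -/
theorem sasaki_prod {α β : Type*} (perp1 : α → α → Prop) (perp2 : β → β → Prop)
    (h1_irrefl : ∀ x, ¬ perp1 x x) (h1_symm : ∀ x y, perp1 x y → perp1 y x)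
    (h2_irrefl : ∀ x, ¬ perp2 x x) (h2_symm : ∀ x y, perp2 x y → perp2 y x)
    (M1 : Set α) (M2 : Set β)
    (hM1 : orthoSet perp1 (orthoSet perp1 M1) = M1)
    (hM2 : orthoSet perp2 (orthoSet perp2 M2) = M2)
    (p1 : α) (p2 : β)
    (hp1 : p1 ∉ orthoSet perp1 M1) (hp2 : p2 ∉ orthoSet perp2 M2) :
    let pp := prodPerp perp1 perp2
    orthoSet pp (orthoSet pp ({(p1, p2)} ∪ orthoSet pp (M1 ×ˢ M2))) ∩ (M1 ×ˢ M2) =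
      (orthoSet perp1 (orthoSet perp1 ({p1} ∪ orthoSet perp1 M1)) ∩ M1) ×ˢ
      (orthoSet perp2 (orthoSet perp2 ({p2} ∪ orthoSet perp2 M2)) ∩ M2) := by
  intro pp
  have hM : orthoSet pp (orthoSet pp (M1 ×ˢ M2)) = M1 ×ˢ M2 :=
    orthoSet_orthoSet_prod h1_irrefl h1_symm h2_irrefl h2_symm hM1 hM2
  ext ⟨y1, y2⟩
  constructor
  · rintro ⟨h, hy1, hy2⟩
    refine ⟨⟨fun x hx => ?_, hy1⟩, ⟨fun x hx => ?_, hy2⟩⟩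
    · obtain ⟨hxp, hxM⟩ := (mem_orthoSet_singleton_union hM1 p1 x).1 hx
      exact (h (x, y2) ((mem_orthoSet_singleton_union hM _ _).2
        ⟨Or.inl hxp, hxM, hy2⟩)).resolve_right (h2_irrefl y2)
    · obtain ⟨hxp, hxM⟩ := (mem_orthoSet_singleton_union hM2 p2 x).1 hx
      exact (h (y1, x) ((mem_orthoSet_singleton_union hM _ _).2
        ⟨Or.inr hxp, hy1, hxM⟩)).resolve_left (h1_irrefl y1)
  · rintro ⟨⟨h1, hy1⟩, ⟨h2, hy2⟩⟩
    refine ⟨fun x hx => ?_, hy1, hy2⟩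
    obtain ⟨hxp, hxM1, hxM2⟩ := (mem_orthoSet_singleton_union hM _ _).1 hx
    exact hxp.imp
      (fun hp => h1 x.1 ((mem_orthoSet_singleton_union hM1 p1 x.1).2 ⟨hp, hxM1⟩))
      (fun hp => h2 x.2 ((mem_orthoSet_singleton_union hM2 p2 x.2).2 ⟨hp, hxM2⟩))
end

section
/- Let (Σ1, ⊥1) and (Σ2, ⊥2) be T1 orthogonality spaces, and equip Σ1 × Σ2 with the product orthogonality. If ¬(p1 ⊥1 q1), then for every p2 ∈ Σ2 the Sasaki projection of (p1, p2) onto {q1} × Σ2 equals {(q1, p2)}: ({(p1, p2)} ∪ ({q1} × Σ2)^⊥)^⊥⊥ ∩ ({q1} × Σ2) = {(q1, p2)}. -/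
/-- In the product of two T1 orthogonality spaces, if `¬ p1 ⊥1 q1`, then the Sasaki
projection of `(p1, p2)` onto `{q1} × Σ2` is the singleton `{(q1, p2)}`. -/
theorem sasaki_line {α β : Type*} (perp1 : α → α → Prop) (perp2 : β → β → Prop)
    (h1_irrefl : ∀ x, ¬ perp1 x x) (h1_symm : ∀ x y, perp1 x y → perp1 y x)
    (h2_irrefl : ∀ x, ¬ perp2 x x) (h2_symm : ∀ x y, perp2 x y → perp2 y x)
    (hT1_1 : ∀ p : α, orthoSet perp1 (orthoSet perp1 {p}) = {p})
    (hT1_2 : ∀ p : β, orthoSet perp2 (orthoSet perp2 {p}) = {p})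
    (p1 q1 : α) (hnp1 : ¬ perp1 p1 q1) (p2 : β) :
    let pp := prodPerp perp1 perp2
    let M : Set (α × β) := ({q1} : Set α) ×ˢ (Set.univ : Set β)
    orthoSet pp (orthoSet pp ({(p1, p2)} ∪ orthoSet pp M)) ∩ M =
      ({(q1, p2)} : Set (α × β)) := by
  have mem_orthoSet_line {a : α} {b : β} :
      (a, b) ∈ orthoSet (prodPerp perp1 perp2) (({q1} : Set α) ×ˢ (Set.univ : Set β)) ↔
        perp1 a q1 := by
    refine ⟨fun h => ?_, fun h => ?_⟩
    · exact (h (q1, b) (by simp)).resolve_right (h2_irrefl b)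
    · rintro ⟨x, y⟩ ⟨rfl, -⟩
      exact Or.inl h
  have mem_orthoSet_union {a : α} {b : β} :
      (a, b) ∈ orthoSet (prodPerp perp1 perp2) ({(p1, p2)} ∪
          orthoSet (prodPerp perp1 perp2) (({q1} : Set α) ×ˢ (Set.univ : Set β))) ↔
        a = q1 ∧ perp2 b p2 := by
    refine ⟨fun h => ?_, ?_⟩
    · have ha : a ∈ orthoSet perp1 (orthoSet perp1 {q1}) := fun c hc =>
        (h (c, b) (Or.inr (mem_orthoSet_line.2 (hc q1 rfl)))).resolve_right (h2_irrefl b)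
      rw [hT1_1] at ha
      obtain rfl : a = q1 := ha
      exact ⟨rfl, (h (p1, p2) (Or.inl rfl)).resolve_left fun h' => hnp1 (h1_symm _ _ h')⟩
    · rintro ⟨rfl, hb⟩ ⟨c, d⟩ (hcd | hcd)
      · obtain ⟨rfl, rfl⟩ := Prod.mk.inj hcd
        exact Or.inr hb
      · exact Or.inl (h1_symm _ _ (mem_orthoSet_line.1 hcd))
  ext ⟨x, y⟩
  constructor
  · rintro ⟨h, rfl, -⟩
    have hy : y ∈ orthoSet perp2 (orthoSet perp2 {p2}) := fun b hb =>
      (h (x, b) (mem_orthoSet_union.2 ⟨rfl, hb p2 rfl⟩)).resolve_left (h1_irrefl x)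
    rw [hT1_2] at hy
    obtain rfl : y = p2 := hy
    rfl
  · intro h
    obtain ⟨rfl, rfl⟩ := Prod.mk.inj h
    refine ⟨?_, rfl, trivial⟩
    rintro ⟨a, b⟩ hab
    exact Or.inr (h2_symm _ _ (mem_orthoSet_union.1 hab).2)
end

section
/- Let (Σ1, ⊥1) and (Σ2, ⊥2) be T1 orthogonality spaces, and equip Σ1 × Σ2 with the product orthogonality. Let q1 ≠ r1 in Σ1, q2 ≠ r2 in Σ2, and set M = {(q1, q2), (r1, r2)}. If (p1, p2) ∈ Σ1 × Σ2 satisfies ¬(p1 ⊥1 q1), ¬(p1 ⊥1 r1), ¬(p2 ⊥2 q2) and ¬(p2 ⊥2 r2), then the Sasaki projection of (p1, p2) onto M is all of M: ({(p1, p2)} ∪ M^⊥)^⊥⊥ ∩ M = M. In particular it is a two-element set, not a singleton. -/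
/-- In a T1 orthogonality relation, points orthogonal to everything orthogonal to `q`
equal `q`. -/
theorem eq_of_forall_perp {α : Type*} {perp : α → α → Prop} {s q : α}
    (hT1 : orthoSet perp (orthoSet perp {q}) = {q})
    (h : ∀ x, perp x q → perp s x) : s = q := by
  have hs : s ∈ orthoSet perp (orthoSet perp {q}) := fun x hx => h x (hx q rfl)
  rwa [hT1] at hs

/-- If `z` is orthogonal to all `(x, y)` with `x ⊥ a` and `y ⊥ b`, then `z` has first
coordinate `a` or second coordinate `b`. -/
theorem fst_eq_or_snd_eq_of_forall_prodPerp {α β : Type*} {perp1 : α → α → Prop}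
    {perp2 : β → β → Prop} {a : α} {b : β} {z : α × β}
    (hT1_1 : orthoSet perp1 (orthoSet perp1 {a}) = {a})
    (hT1_2 : orthoSet perp2 (orthoSet perp2 {b}) = {b})
    (h : ∀ x y, perp1 x a → perp2 y b → prodPerp perp1 perp2 z (x, y)) :
    z.1 = a ∨ z.2 = b := by
  by_contra! hne
  refine hne.1 (eq_of_forall_perp hT1_1 fun x hx => ?_)
  by_contra hzx
  exact hne.2 (eq_of_forall_perp hT1_2 fun y hy => (h x y hx hy).resolve_left hzx)

/-- Two points of a product of T1 spaces that differ in both coordinates form a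
biorthogonally closed set. -/
theorem orthoSet_orthoSet_pair_subset {α β : Type*} {perp1 : α → α → Prop}
    {perp2 : β → β → Prop}
    (hT1_1 : ∀ p : α, orthoSet perp1 (orthoSet perp1 {p}) = {p})
    (hT1_2 : ∀ p : β, orthoSet perp2 (orthoSet perp2 {p}) = {p})
    {q1 r1 : α} {q2 r2 : β} (hq1r1 : q1 ≠ r1) (hq2r2 : q2 ≠ r2) :
    orthoSet (prodPerp perp1 perp2)
        (orthoSet (prodPerp perp1 perp2) {(q1, q2), (r1, r2)}) ⊆
      {(q1, q2), (r1, r2)} := by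
  intro z hz
  have hqr : z.1 = q1 ∨ z.2 = r2 :=
    fst_eq_or_snd_eq_of_forall_prodPerp (hT1_1 q1) (hT1_2 r2) fun x y hx hy =>
      hz (x, y) (by rintro _ (rfl | rfl); exacts [Or.inl hx, Or.inr hy])
  have hrq : z.1 = r1 ∨ z.2 = q2 :=
    fst_eq_or_snd_eq_of_forall_prodPerp (hT1_1 r1) (hT1_2 q2) fun x y hx hy =>
      hz (x, y) (by rintro _ (rfl | rfl); exacts [Or.inr hy, Or.inl hx])
  simp only [Set.mem_insert_iff, Set.mem_singleton_iff, Prod.ext_iff]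
  grind

/-- In the product of two T1 orthogonality spaces, let `M = {(q1, q2), (r1, r2)}` with
`q1 ≠ r1` and `q2 ≠ r2`. If `(p1, p2)` is such that `p1` is non-orthogonal to both `q1`
and `r1`, and `p2` is non-orthogonal to both `q2` and `r2`, then the Sasaki projection of
`(p1, p2)` onto `M` is all of `M`; in particular it is a two-element set, not a
singleton. -/
theorem sasaki_two_element {α β : Type*} (perp1 : α → α → Prop) (perp2 : β → β → Prop)
    (h1_irrefl : ∀ x, ¬ perp1 x x) (h1_symm : ∀ x y, perp1 x y → perp1 y x)
    (h2_irrefl : ∀ x, ¬ perp2 x x) (h2_symm : ∀ x y, perp2 x y → perp2 y x)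
    (hT1_1 : ∀ p : α, orthoSet perp1 (orthoSet perp1 {p}) = {p})
    (hT1_2 : ∀ p : β, orthoSet perp2 (orthoSet perp2 {p}) = {p})
    (p1 q1 r1 : α) (p2 q2 r2 : β) (hq1r1 : q1 ≠ r1) (hq2r2 : q2 ≠ r2)
    (h1q : ¬ perp1 p1 q1) (h1r : ¬ perp1 p1 r1)
    (h2q : ¬ perp2 p2 q2) (h2r : ¬ perp2 p2 r2) :
    let pp := prodPerp perp1 perp2
    let M : Set (α × β) := {(q1, q2), (r1, r2)}
    orthoSet pp (orthoSet pp ({(p1, p2)} ∪ orthoSet pp M)) ∩ M = M ∧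
    ¬ ∃ x : α × β,
        orthoSet pp (orthoSet pp ({(p1, p2)} ∪ orthoSet pp M)) ∩ M = {x} := by
  intro pp M
  have hM : orthoSet pp (orthoSet pp ({(p1, p2)} ∪ orthoSet pp M)) ∩ M = M := by
    refine Set.inter_eq_right.2 fun m _ z hz => ?_
    have hzp : perp1 z.1 p1 ∨ perp2 z.2 p2 := hz _ (Or.inl rfl)
    have hzM : z ∈ M := orthoSet_orthoSet_pair_subset hT1_1 hT1_2 hq1r1 hq2r2
      fun w hw => hz w (Or.inr hw)
    rcases hzM with rfl | rfl
    · exact (hzp.elim (fun h => h1q (h1_symm _ _ h)) fun h => h2q (h2_symm _ _ h)).elim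
    · exact (hzp.elim (fun h => h1r (h1_symm _ _ h)) fun h => h2r (h2_symm _ _ h)).elim
  refine ⟨hM, ?_⟩
  rintro ⟨x, hx⟩
  rw [hM] at hx
  have hq : (q1, q2) ∈ ({x} : Set (α × β)) := hx ▸ Or.inl rfl
  have hr : (r1, r2) ∈ ({x} : Set (α × β)) := hx ▸ Or.inr rfl
  exact hq1r1 (congrArg Prod.fst (hq.trans hr.symm))
end

section
/- Let (Σ1, ⊥1) and (Σ2, ⊥2) be Sasaki regular T1 orthogonality spaces whose orthogonality relations are non-trivial, in the sense that there exist p1 ≠ q1 in Σ1 with ¬(p1 ⊥1 q1) and p2 ≠ q2 in Σ2 with ¬(p2 ⊥2 q2). Then the product orthogonality space (Σ1 × Σ2, ⊥) is not Sasaki regular: there exist a biorthogonally closed subset M ⊆ Σ1 × Σ2 and a point p ∈ Σ1 × Σ2 with p ∉ M^⊥ such that ({p} ∪ M^⊥)^⊥⊥ ∩ M is not a singleton. -/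
/-- An orthogonality space is Sasaki regular if for every biorthogonally closed `M` and
every point `p ∉ M^⊥`, the Sasaki projection `({p} ∪ M^⊥)^⊥⊥ ∩ M` is a singleton. -/
def SasakiRegular {α : Type*} (perp : α → α → Prop) : Prop :=
  ∀ M : Set α, orthoSet perp (orthoSet perp M) = M →
    ∀ p : α, p ∉ orthoSet perp M →
      ∃ q : α, orthoSet perp (orthoSet perp ({p} ∪ orthoSet perp M)) ∩ M = {q}

section OrthoSet

variable {γ δ : Type*} {r : γ → γ → Prop} {s : δ → δ → Prop}

theorem orthoSet_triple (hr : ∀ x y, r x y → r y x) (A : Set γ) :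
    orthoSet r (orthoSet r (orthoSet r A)) = orthoSet r A :=
  Set.Subset.antisymm (fun _ hx a ha => hx a fun _ hy => hr _ _ (hy a ha))
    fun _ hx _ hy => hr _ _ (hy _ hx)

/-- In a product, a point orthogonal to a rectangle is orthogonal to one of its sides. -/
theorem mem_orthoSet_prod {A : Set γ} {B : Set δ} {x : γ × δ} :
    x ∈ orthoSet (prodPerp r s) (A ×ˢ B) ↔ x.1 ∈ orthoSet r A ∨ x.2 ∈ orthoSet s B := by
  constructor
  · intro hx
    by_contra! h
    simp only [orthoSet, Set.mem_ofPred_eq, not_forall] at h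
    obtain ⟨⟨a, ha, hxa⟩, b, hb, hxb⟩ := h
    exact (hx (a, b) ⟨ha, hb⟩).elim hxa hxb
  · rintro (h | h) y hy
    exacts [Or.inl (h _ hy.1), Or.inr (h _ hy.2)]

theorem prodPerp_symm (hr : ∀ x y, r x y → r y x) (hs : ∀ x y, s x y → s y x)
    (x y : γ × δ) (h : prodPerp r s x y) : prodPerp r s y x :=
  h.imp (hr _ _) (hs _ _)

theorem orthoSet_antitone {A B : Set γ} (h : A ⊆ B) : orthoSet r B ⊆ orthoSet r A :=
  fun _ hx a ha => hx a (h ha)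

/-- The product of T1 orthogonality spaces is T1. -/
theorem biortho_singleton_prod_subset (hr : ∀ x, ¬ r x x) (hs : ∀ x, ¬ s x x)
    (hTr : ∀ x, orthoSet r (orthoSet r {x}) = {x})
    (hTs : ∀ x, orthoSet s (orthoSet s {x}) = {x}) (p : γ × δ) :
    orthoSet (prodPerp r s) (orthoSet (prodPerp r s) {p}) ⊆ {p} := by
  intro x hx
  have hleft : x ∈ orthoSet (prodPerp r s) (orthoSet r {p.1} ×ˢ Set.univ) := by
    refine orthoSet_antitone ?_ hx
    rintro y ⟨hy, -⟩ _ rfl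
    exact Or.inl (hy _ rfl)
  have hright : x ∈ orthoSet (prodPerp r s) (Set.univ ×ˢ orthoSet s {p.2}) := by
    refine orthoSet_antitone ?_ hx
    rintro y ⟨-, hy⟩ _ rfl
    exact Or.inr (hy _ rfl)
  rw [mem_orthoSet_prod, hTr] at hleft
  rw [mem_orthoSet_prod, hTs] at hright
  exact Prod.ext (hleft.resolve_right fun h => hs _ (h _ trivial))
    (hright.resolve_left fun h => hr _ (h _ trivial))

/-- Two points of a product of T1 orthogonality spaces that differ in both coordinates
form a biorthogonally closed set. -/
theorem biortho_pair_prod_subset (hTr : ∀ x, orthoSet r (orthoSet r {x}) = {x})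
    (hTs : ∀ x, orthoSet s (orthoSet s {x}) = {x}) {p q : γ × δ}
    (h1 : p.1 ≠ q.1) (h2 : p.2 ≠ q.2) :
    orthoSet (prodPerp r s) (orthoSet (prodPerp r s) {p, q}) ⊆ {p, q} := by
  intro x hx
  have hpq : x ∈ orthoSet (prodPerp r s) (orthoSet r {p.1} ×ˢ orthoSet s {q.2}) := by
    refine orthoSet_antitone ?_ hx
    rintro y ⟨hy, hy'⟩ _ (rfl | rfl)
    exacts [Or.inl (hy _ rfl), Or.inr (hy' _ rfl)]
  have hqp : x ∈ orthoSet (prodPerp r s) (orthoSet r {q.1} ×ˢ orthoSet s {p.2}) := by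
    refine orthoSet_antitone ?_ hx
    rintro y ⟨hy, hy'⟩ _ (rfl | rfl)
    exacts [Or.inr (hy' _ rfl), Or.inl (hy _ rfl)]
  rw [mem_orthoSet_prod, hTr, hTs] at hpq hqp
  simp only [Set.mem_singleton_iff] at hpq hqp
  rcases hpq with h | h <;> rcases hqp with h' | h'
  · exact absurd (h.symm.trans h') h1
  · exact Or.inl (Prod.ext h h')
  · exact Or.inr (Prod.ext h' h)
  · exact absurd (h'.symm.trans h) h2

end OrthoSet

/-- If `(Σ1, ⊥1)` and `(Σ2, ⊥2)` are Sasaki regular T1 orthogonality spaces with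
non-trivial orthogonality relations, then the product orthogonality space is not Sasaki
regular: there are a biorthogonally closed `M ⊆ Σ1 × Σ2` and a point `p ∉ M^⊥` whose
Sasaki projection onto `M` is not a singleton. -/
theorem prod_not_sasakiRegular {α β : Type*} (perp1 : α → α → Prop) (perp2 : β → β → Prop)
    (h1_irrefl : ∀ x, ¬ perp1 x x) (h1_symm : ∀ x y, perp1 x y → perp1 y x)
    (h2_irrefl : ∀ x, ¬ perp2 x x) (h2_symm : ∀ x y, perp2 x y → perp2 y x)
    (hT1_1 : ∀ p : α, orthoSet perp1 (orthoSet perp1 {p}) = {p})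
    (hT1_2 : ∀ p : β, orthoSet perp2 (orthoSet perp2 {p}) = {p})
    (hreg1 : SasakiRegular perp1) (hreg2 : SasakiRegular perp2)
    (hnt1 : ∃ p q : α, p ≠ q ∧ ¬ perp1 p q)
    (hnt2 : ∃ p q : β, p ≠ q ∧ ¬ perp2 p q) :
    ∃ M : Set (α × β),
      orthoSet (prodPerp perp1 perp2) (orthoSet (prodPerp perp1 perp2) M) = M ∧
      ∃ p : α × β, p ∉ orthoSet (prodPerp perp1 perp2) M ∧
        ¬ ∃ q : α × β,
            orthoSet (prodPerp perp1 perp2)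
                (orthoSet (prodPerp perp1 perp2) ({p} ∪ orthoSet (prodPerp perp1 perp2) M)) ∩
              M = {q} := by
  obtain ⟨p1, q1, hne1, hp1⟩ := hnt1
  obtain ⟨p2, q2, hne2, hp2⟩ := hnt2
  have hsymm := prodPerp_symm h1_symm h2_symm
  refine ⟨orthoSet (prodPerp perp1 perp2) {(p1, p2)}, orthoSet_triple hsymm _, (q1, q2),
    fun hq => ?_, ?_⟩
  · have h := biortho_singleton_prod_subset h1_irrefl h2_irrefl hT1_1 hT1_2 _ hq
    exact hne1 (congrArg Prod.fst h).symm
  · rintro ⟨x, hx⟩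
    obtain ⟨hxs, hxp⟩ := hx.ge rfl
    have hxpq : x ∈ ({(p1, p2), (q1, q2)} : Set (α × β)) := by
      refine biortho_pair_prod_subset hT1_1 hT1_2 hne1 hne2
        (orthoSet_antitone (orthoSet_antitone ?_) hxs)
      rintro y (rfl | hy)
      · exact Or.inr rfl
      · exact Or.inl (biortho_singleton_prod_subset h1_irrefl h2_irrefl hT1_1 hT1_2 _ hy)
    have hperp := hxp _ rfl
    rcases hxpq with rfl | rfl
    · exact hperp.elim (h1_irrefl _) (h2_irrefl _)
    · exact (hsymm _ _ hperp).elim hp1 hp2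
end
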